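/- Let k ≥ 1 and let a_0 < a_1 < ⋯ < a_k and b_0 < b_1 < ⋯ < b_k be nonnegative real numbers. Let S_k be the (k+1)×(k+1) symmetric tridiagonal matrix with diagonal entries b_0,…,b_k and off-diagonal entries a_0,…,a_{k−1}, and let λmax(S_k) denote its largest eigenvalue. Then for every s = 1,…,k+1: (1/s)·(2(s−1)·a_{k−s+1} + s·b_{k−s+1}) ≤ λmax(S_k) ≤ a_{k−1} + max(a_{k−1}+b_{k−1}, b_k). -/

import Mathlib

/-- Symmetric tridiagonal (k+1)×(k+1) matrix with diagonal `d 0, …, d k` and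
off-diagonal `o 0, …, o (k-1)`. -/
noncomputable def Tridiag (k : ℕ) (d o : ℕ → ℝ) : Matrix (Fin (k + 1)) (Fin (k + 1)) ℝ :=
  Matrix.of fun i j =>
    if (i : ℕ) = (j : ℕ) then d i
    else if (i : ℕ) + 1 = (j : ℕ) then o i
    else if (j : ℕ) + 1 = (i : ℕ) then o j
    else 0

/-- The largest eigenvalue of a real square matrix. -/
noncomputable def maxEig {m : ℕ} (M : Matrix (Fin m) (Fin m) ℝ) : ℝ :=
  sSup {μ : ℝ | Module.End.HasEigenvalue (Matrix.toLin' M) μ}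


theorem Tridiag_isHermitian (k : ℕ) (d o : ℕ → ℝ) : (Tridiag k d o).IsHermitian := by
  ext i j
  simp only [Matrix.conjTranspose_apply, Tridiag, Matrix.of_apply, star_trivial]
  split_ifs <;> first | rfl | omega | simp_all

open scoped Matrix in
/-- Rayleigh's bound: the quadratic form of a symmetric matrix is at most its largest eigenvalue
times the squared norm. -/
theorem Matrix.IsHermitian.dotProduct_mulVec_le_maxEig {m : ℕ} {M : Matrix (Fin m) (Fin m) ℝ}
    (hM : M.IsHermitian) (x : Fin m → ℝ) : x ⬝ᵥ (M *ᵥ x) ≤ maxEig M * (x ⬝ᵥ x) := by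
  have hbdd : BddAbove {μ : ℝ | Module.End.HasEigenvalue (Matrix.toLin' M) μ} :=
    (Module.End.finite_hasEigenvalue (Matrix.toLin' M)).bddAbove
  have hN : (maxEig M • (1 : Matrix (Fin m) (Fin m) ℝ) - M).IsHermitian := by
    ext i j
    have := hM.apply i j
    simp only [star_trivial] at this
    simp [Matrix.one_apply, this, eq_comm]
  have hpos : (maxEig M • (1 : Matrix (Fin m) (Fin m) ℝ) - M).PosSemidef := by
    rw [hN.posSemidef_iff_eigenvalues_nonneg]
    intro i
    have hv := hN.mulVec_eigenvectorBasis i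
    have hne : (hN.eigenvectorBasis i).ofLp ≠ 0 := fun h =>
      hN.eigenvectorBasis.orthonormal.ne_zero i (by ext j; exact congrFun h j)
    have heig : Module.End.HasEigenvalue (Matrix.toLin' M) (maxEig M - hN.eigenvalues i) := by
      refine Module.End.hasEigenvalue_of_hasEigenvector
        (x := (hN.eigenvectorBasis i).ofLp) ⟨?_, hne⟩
      rw [Module.End.mem_eigenspace_iff, Matrix.toLin'_apply, sub_smul, ← hv, Matrix.sub_mulVec,
        Matrix.smul_mulVec, Matrix.one_mulVec, sub_sub_cancel]
    have hle : maxEig M - hN.eigenvalues i ≤ maxEig M := le_csSup hbdd heig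
    simpa using hle
  have h := hpos.dotProduct_mulVec_nonneg x
  rw [Matrix.sub_mulVec, Matrix.smul_mulVec, Matrix.one_mulVec, dotProduct_sub,
    dotProduct_smul, star_trivial, smul_eq_mul] at h
  linarith

open scoped Matrix in
theorem Tridiag_dotProduct_mulVec (k : ℕ) (d o x : ℕ → ℝ) :
    (fun i : Fin (k + 1) => x i) ⬝ᵥ (Tridiag k d o *ᵥ fun i => x i) =
      ∑ i ∈ Finset.range (k + 1), d i * x i ^ 2
        + 2 * ∑ i ∈ Finset.range k, o i * (x i * x (i + 1)) := by
  induction k with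
  | zero =>
    simp [dotProduct, Matrix.mulVec, Tridiag]
    ring
  | succ k ih =>
    have hblock : ∀ i j : Fin (k + 1),
        Tridiag (k + 1) d o i.castSucc j.castSucc = Tridiag k d o i j := fun i j => by
      simp [Tridiag]
    have hcol : ∀ i : Fin (k + 1),
        Tridiag (k + 1) d o i.castSucc (Fin.last (k + 1)) = if i = Fin.last k then o k else 0 := by
      intro i
      have := i.isLt
      simp only [Tridiag, Matrix.of_apply, Fin.ext_iff, Fin.val_castSucc, Fin.val_last]
      split_ifs <;> first | rfl | omega | simp_all
    have hrow : ∀ i : Fin (k + 1),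
        Tridiag (k + 1) d o (Fin.last (k + 1)) i.castSucc = if i = Fin.last k then o k else 0 :=
      fun i => by rw [← hcol i]; simpa using (Tridiag_isHermitian (k + 1) d o).apply _ _
    have hlast : Tridiag (k + 1) d o (Fin.last (k + 1)) (Fin.last (k + 1)) = d (k + 1) := by
      simp [Tridiag]
    simp only [dotProduct, Matrix.mulVec] at ih ⊢
    rw [Fin.sum_univ_castSucc, Finset.sum_range_succ _ (k + 1)]
    simp only [Fin.sum_univ_castSucc (n := k + 1), hblock, hcol, hrow, hlast, mul_add,
      Finset.sum_add_distrib, Fin.val_castSucc, Fin.val_last, ih, ite_mul, mul_ite, zero_mul,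
      mul_zero, Finset.sum_ite_eq', Finset.mem_univ, if_true]
    rw [Finset.sum_range_succ (fun i => o i * (x i * x (i + 1)))]
    ring

theorem Tridiag_sum_norm_erase_le (k : ℕ) (d o : ℕ → ℝ) (i : Fin (k + 1)) :
    ∑ j ∈ Finset.univ.erase i, ‖Tridiag k d o i j‖ ≤
      (if (i : ℕ) < k then |o i| else 0) + if 0 < (i : ℕ) then |o (i - 1)| else 0 := by
  have hterm : ∀ j ∈ Finset.univ.erase i, ‖Tridiag k d o i j‖ ≤
      (if (j : ℕ) = i + 1 then |o i| else 0)
        + if (j : ℕ) = i - 1 then (if 0 < (i : ℕ) then |o (i - 1)| else 0) else 0 := by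
    intro j hj
    have hne : (i : ℕ) ≠ j := fun h => (Finset.ne_of_mem_erase hj) (Fin.ext h.symm)
    simp only [Tridiag, Matrix.of_apply, if_neg hne, Real.norm_eq_abs]
    rcases lt_trichotomy ((i : ℕ) + 1) j with h | h | h
    · rw [if_neg (by omega), if_neg (by omega), abs_zero]
      positivity
    · rw [if_pos h, if_pos h.symm]
      exact le_add_of_nonneg_right (by positivity)
    · rw [if_neg (by omega)]
      by_cases h' : (j : ℕ) + 1 = i
      · have : (j : ℕ) = i - 1 := by omega
        rw [if_pos h', if_pos this, if_pos (show 0 < (i : ℕ) by omega), this]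
        refine le_add_of_nonneg_left ?_
        positivity
      · rw [if_neg h', abs_zero]
        positivity
  refine (Finset.sum_le_sum hterm).trans ((Finset.sum_le_sum_of_subset_of_nonneg
    (Finset.erase_subset _ _) fun j _ _ => by positivity).trans (le_of_eq ?_))
  have hi := i.isLt
  rw [Finset.sum_add_distrib,
    Fin.sum_univ_eq_sum_range (fun j => if j = (i : ℕ) + 1 then |o i| else 0),
    Fin.sum_univ_eq_sum_range
      (fun j => if j = (i : ℕ) - 1 then (if 0 < (i : ℕ) then |o (i - 1)| else 0) else 0),
    Finset.sum_ite_eq', Finset.sum_ite_eq']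
  simp only [Finset.mem_range, Nat.add_lt_add_iff_right]
  rw [if_pos (show (i : ℕ) - 1 < k + 1 by omega)]

theorem mul_le_sum_range_mul_indicator (p n : ℕ) (f : ℕ → ℝ) (c : ℝ)
    (h : ∀ i < n, c ≤ f (p + i)) :
    n * c ≤ ∑ i ∈ Finset.range (p + n), f i * if p ≤ i then 1 else 0 := by
  rw [Finset.sum_range_add, Finset.sum_eq_zero, zero_add]
  · have := Finset.card_nsmul_le_sum (Finset.range n) (fun i => f (p + i)) c
      fun i hi => h i (Finset.mem_range.1 hi)
    simpa using this
  · intro i hi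
    rw [if_neg (by simpa using hi), mul_zero]

theorem le_of_forall_lt_succ {k : ℕ} {f : ℕ → ℝ} (hf : ∀ i < k, f i < f (i + 1)) {i j : ℕ}
    (hij : i ≤ j) (hj : j ≤ k) : f i ≤ f j := by
  induction j, hij using Nat.le_induction with
  | base => exact le_rfl
  | succ j _ ih => exact (ih (by omega)).trans (hf j (by omega)).le

/-- Lemma 2: bounds on the largest eigenvalue of a nonnegative symmetric tridiagonal
matrix with strictly increasing entries. -/
theorem tridiag_maxEig_bounds (k : ℕ) (hk : 1 ≤ k) (a b : ℕ → ℝ)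
    (hapos : ∀ i ≤ k, 0 ≤ a i) (hbpos : ∀ i ≤ k, 0 ≤ b i)
    (hamono : ∀ i < k, a i < a (i + 1)) (hbmono : ∀ i < k, b i < b (i + 1))
    (s : ℕ) (hs1 : 1 ≤ s) (hs2 : s ≤ k + 1) :
    (1 / (s : ℝ)) * (2 * ((s : ℝ) - 1) * a (k + 1 - s) + (s : ℝ) * b (k + 1 - s))
        ≤ maxEig (Tridiag k b a)
      ∧ maxEig (Tridiag k b a) ≤ a (k - 1) + max (a (k - 1) + b (k - 1)) (b k) := by
  constructor
  · obtain ⟨t, rfl⟩ : ∃ t, s = t + 1 := ⟨s - 1, by omega⟩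
    obtain ⟨p, rfl⟩ : ∃ p, k = p + t := ⟨k - t, by omega⟩
    have hp : p + t + 1 - (t + 1) = p := by omega
    rw [hp]
    set x : ℕ → ℝ := fun i => if p ≤ i then 1 else 0 with hx
    have hray := (Tridiag_isHermitian (p + t) b a).dotProduct_mulVec_le_maxEig fun i => x i
    have hb := mul_le_sum_range_mul_indicator p (t + 1) b (b p) fun i hi =>
      le_of_forall_lt_succ hbmono (by omega) (by omega)
    have ha := mul_le_sum_range_mul_indicator p t a (a p) fun i hi =>
      le_of_forall_lt_succ hamono (by omega) (by omega)
    have hsq : ∀ i, x i ^ 2 = if p ≤ i then 1 else 0 := fun i => by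
      simp only [hx]; split_ifs <;> norm_num
    have hmul : ∀ i, x i * x (i + 1) = if p ≤ i then 1 else 0 := fun i => by
      simp only [hx]; split_ifs <;> first | omega | norm_num
    have hnorm : (fun i : Fin (p + t + 1) => x i) ⬝ᵥ (fun i => x i) = t + 1 := by
      simp only [dotProduct, ← pow_two]
      rw [Fin.sum_univ_eq_sum_range (fun i => x i ^ 2), add_assoc, Finset.sum_range_add,
        Finset.sum_eq_zero]
      · simp [hx]
      · intro i hi
        rw [hsq, if_neg (by simpa using hi)]
    rw [Tridiag_dotProduct_mulVec, hnorm] at hray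
    simp only [hsq, hmul] at hray
    rw [← add_assoc] at hb
    push_cast at hb ⊢
    rw [one_div, inv_mul_le_iff₀ (by positivity)]
    linarith
  · have hak := hapos (k - 1) (by omega)
    have hbk := hbpos k le_rfl
    have hm1 := le_max_left (a (k - 1) + b (k - 1)) (b k)
    have hm2 := le_max_right (a (k - 1) + b (k - 1)) (b k)
    refine Real.sSup_le (fun μ hμ => ?_) (by linarith)
    obtain ⟨i, hi⟩ := eigenvalue_mem_ball hμ
    have hsum := Tridiag_sum_norm_erase_le k b a i
    have hdiag : Tridiag k b a i i = b i := by simp [Tridiag]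
    rw [Metric.mem_closedBall, Real.dist_eq, hdiag] at hi
    have hμ' := (le_abs_self _).trans (hi.trans hsum)
    have hik := i.isLt
    have hprev : (if 0 < (i : ℕ) then |a (i - 1)| else 0) ≤ a (k - 1) := by
      split_ifs
      · rw [abs_of_nonneg (hapos _ (by omega))]
        exact le_of_forall_lt_succ hamono (by omega) (by omega)
      · exact hak
    by_cases h : (i : ℕ) < k
    · rw [if_pos h, abs_of_nonneg (hapos _ h.le)] at hμ'
      have h1 : a i ≤ a (k - 1) := le_of_forall_lt_succ hamono (by omega) (by omega)
      have h2 : b i ≤ b (k - 1) := le_of_forall_lt_succ hbmono (by omega) (by omega)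
      linarith
    · rw [if_neg h, show (i : ℕ) = k by omega] at hμ'
      rw [show (i : ℕ) = k by omega] at hprev
      linarith
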